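/- arXiv:1112.1716 — 3 statements merged into one kernel-verified Lean document; each statement's English description precedes it below -/
import Mathlib

section
/- Let (Ω, P) be a probability space and let 𝒱 be a nonzero finite-dimensional linear subspace of L^∞(Ω, P) (hence 𝒱 ⊆ L²(Ω, P) since P is a probability measure). Then there exists ψ ∈ 𝒱 with ψ ≠ 0 such that ‖ψ‖_{L^∞(Ω,P)} ≥ √(dim 𝒱) · ‖ψ‖_{L²(Ω,P)}. -/
open MeasureTheory

namespace MeasureTheory.Lp

variable {Ω : Type*} [MeasurableSpace Ω] {P : Measure Ω}

lemma coeFn_sum_smul {p : ENNReal} {ι : Type*} (s : Finset ι) (c : ι → ℝ) (f : ι → Lp ℝ p P) :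
    ⇑(∑ i ∈ s, c i • f i) =ᵐ[P] fun x ↦ ∑ i ∈ s, c i * f i x := by
  classical
  induction s using Finset.induction_on with
  | empty =>
    simp only [Finset.sum_empty]
    exact Lp.coeFn_zero ℝ p P
  | insert i s hi ih =>
    simp only [Finset.sum_insert hi]
    filter_upwards [Lp.coeFn_add (c i • f i) (∑ j ∈ s, c j • f j), Lp.coeFn_smul (c i) (f i), ih]
      with x hx hx' hx''
    rw [hx, Pi.add_apply, hx', hx'', Pi.smul_apply, smul_eq_mul]

lemma ae_abs_le_norm_top (f : Lp ℝ ⊤ P) : ∀ᵐ x ∂P, |f x| ≤ ‖f‖ := by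
  have h : ∀ᵐ x ∂P, ‖f x‖ₑ ≤ eLpNorm f ⊤ P := by
    simpa only [eLpNorm_exponent_top] using ae_le_eLpNormEssSup (f := f) (μ := P)
  filter_upwards [h] with x hx
  rw [← Real.norm_eq_abs, ← toReal_enorm, Lp.norm_def]
  exact ENNReal.toReal_mono (Lp.eLpNorm_ne_top f) hx

/-- Almost every point satisfies the sup-norm bound simultaneously for all linear combinations. -/
lemma ae_forall_abs_sum_le_norm {n : ℕ} (L : EuclideanSpace ℝ (Fin n) →ₗ[ℝ] Lp ℝ ⊤ P) :
    ∀ᵐ x ∂P, ∀ c : EuclideanSpace ℝ (Fin n),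
      |∑ i, c i * L (EuclideanSpace.single i 1) x| ≤ ‖L c‖ := by
  have hL : Continuous L := L.continuous_of_finiteDimensional
  have h (c : EuclideanSpace ℝ (Fin n)) :
      ∀ᵐ x ∂P, |∑ i, c i * L (EuclideanSpace.single i 1) x| ≤ ‖L c‖ := by
    have hc : L c = ∑ i, c i • L (EuclideanSpace.single i 1) := by
      conv_lhs => rw [← (EuclideanSpace.basisFun (Fin n) ℝ).sum_repr c]
      simp
    filter_upwards [ae_abs_le_norm_top (L c),
      coeFn_sum_smul Finset.univ c fun i ↦ L (EuclideanSpace.single i 1)] with x hx hs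
    rwa [← hs, ← hc]
  filter_upwards [ae_all_iff.2 fun k ↦ h (TopologicalSpace.denseSeq _ k)] with x hx c
  have hclosed : IsClosed {c : EuclideanSpace ℝ (Fin n) |
      |∑ i, c i * L (EuclideanSpace.single i 1) x| ≤ ‖L c‖} :=
    isClosed_le (by fun_prop) hL.norm
  exact isClosed_property (TopologicalSpace.denseRange_denseSeq _) hclosed hx c

variable [IsProbabilityMeasure P]

lemma memLp_two_of_top (f : Lp ℝ ⊤ P) : MemLp f 2 P :=
  (Lp.memLp f).mono_exponent le_top

/-- The inclusion of `L^∞` into `L²` for a probability measure. -/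
noncomputable def topToTwo (P : Measure Ω) [IsProbabilityMeasure P] :
    Lp ℝ ⊤ P →ₗ[ℝ] Lp ℝ 2 P where
  toFun f := (memLp_two_of_top f).toLp f
  map_add' f g := by
    rw [← MemLp.toLp_add, MemLp.toLp_eq_toLp_iff]
    exact Lp.coeFn_add f g
  map_smul' c f := by
    rw [RingHom.id_apply, ← MemLp.toLp_const_smul, MemLp.toLp_eq_toLp_iff]
    exact Lp.coeFn_smul c f

lemma coeFn_topToTwo (f : Lp ℝ ⊤ P) : topToTwo P f =ᵐ[P] f :=
  (memLp_two_of_top f).coeFn_toLp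

lemma norm_topToTwo (f : Lp ℝ ⊤ P) : ‖topToTwo P f‖ = (eLpNorm f 2 P).toReal :=
  Lp.norm_toLp f (memLp_two_of_top f)

lemma topToTwo_injective : Function.Injective (topToTwo P) := by
  intro f g h
  refine Lp.ext ?_
  filter_upwards [coeFn_topToTwo f, coeFn_topToTwo g] with x hf hg
  rw [← hf, h, hg]

lemma integral_sq_eq_norm_topToTwo_sq (f : Lp ℝ ⊤ P) :
    ∫ x, f x ^ 2 ∂P = ‖topToTwo P f‖ ^ 2 := by
  rw [← real_inner_self_eq_norm_sq, L2.inner_def]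
  refine integral_congr_ae ?_
  filter_upwards [coeFn_topToTwo f] with x hx
  rw [hx, real_inner_self_eq_norm_sq, Real.norm_eq_abs, sq_abs]

/-- A finite-dimensional subspace of `L^∞` is parametrized by a Euclidean space, isometrically for
the `L²` norm. -/
lemma exists_linearEquiv_norm_topToTwo (V : Submodule ℝ (Lp ℝ ⊤ P)) [FiniteDimensional ℝ V] :
    ∃ L : EuclideanSpace ℝ (Fin (Module.finrank ℝ V)) ≃ₗ[ℝ] V,
      ∀ c, ‖topToTwo P (L c)‖ = ‖c‖ := by
  let T : V ≃ₗ[ℝ] V.map (topToTwo P) := V.equivMapOfInjective _ topToTwo_injective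
  have : FiniteDimensional ℝ (V.map (topToTwo P)) := T.finiteDimensional
  let b := (stdOrthonormalBasis ℝ (V.map (topToTwo P))).reindex (finCongr T.finrank_eq.symm)
  refine ⟨b.repr.symm.toLinearEquiv.trans T.symm, fun c ↦ ?_⟩
  have h : topToTwo P (T.symm (b.repr.symm c)) = b.repr.symm c := by
    rw [← Submodule.coe_equivMapOfInjective_apply _ topToTwo_injective]
    exact congrArg Subtype.val (T.apply_symm_apply _)
  change ‖topToTwo P (T.symm (b.repr.symm c))‖ = ‖c‖
  rw [h]
  exact b.repr.symm.norm_map c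

end MeasureTheory.Lp

/-- Let `(Ω, P)` be a probability space and let `𝒱` be a nonzero
finite-dimensional linear subspace of `L^∞(Ω, P)`.  Then there exists `ψ ∈ 𝒱`, `ψ ≠ 0`,
with `‖ψ‖_{L^∞} ≥ √(dim 𝒱) · ‖ψ‖_{L²}`. -/
theorem exists_large_sup_norm_of_finiteDimensional
    {Ω : Type*} [MeasurableSpace Ω] (P : Measure Ω) [IsProbabilityMeasure P]
    (𝒱 : Submodule ℝ (Lp ℝ ⊤ P)) [FiniteDimensional ℝ 𝒱] (h𝒱 : 𝒱 ≠ ⊥) :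
    ∃ ψ ∈ 𝒱, ψ ≠ 0 ∧
      Real.sqrt (Module.finrank ℝ 𝒱) * (eLpNorm (ψ : Ω → ℝ) 2 P).toReal ≤ ‖ψ‖ := by
  by_contra! hlt
  obtain ⟨L, hL⟩ := Lp.exists_linearEquiv_norm_topToTwo 𝒱
  have hd : (0 : ℝ) < Module.finrank ℝ 𝒱 := by
    exact_mod_cast Submodule.one_le_finrank_iff.2 h𝒱
  generalize Module.finrank ℝ 𝒱 = d at *
  have hLlt (c : EuclideanSpace ℝ (Fin d)) (hc : c ≠ 0) : ‖(L c : Lp ℝ ⊤ P)‖ < √d * ‖c‖ := by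
    rw [← hL c, Lp.norm_topToTwo]
    exact hlt _ (L c).2 (by simpa using hc)
  let e (i : Fin d) : Lp ℝ ⊤ P := L (EuclideanSpace.single i 1)
  have hint (i : Fin d) : Integrable (fun x ↦ e i x ^ 2) P :=
    (Lp.memLp_two_of_top (e i)).integrable_sq
  have hpos : ∀ᵐ x ∂P, 0 < d - ∑ i, e i x ^ 2 := by
    filter_upwards [Lp.ae_forall_abs_sum_le_norm (𝒱.subtype ∘ₗ L.toLinearMap)] with x hx
    let a : EuclideanSpace ℝ (Fin d) := WithLp.toLp 2 fun i ↦ e i x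
    have ha : ∑ i, e i x ^ 2 = ‖a‖ ^ 2 := by simp [a, EuclideanSpace.norm_sq_eq]
    rw [ha, sub_pos]
    rcases eq_or_ne a 0 with h0 | h0
    · simpa [h0] using hd
    · have hsum : ∑ i, a i * e i x = ‖a‖ ^ 2 := by simp only [← ha, sq, a]
      have hle : ‖a‖ ^ 2 ≤ ‖(L a : Lp ℝ ⊤ P)‖ := by
        rw [← hsum]
        exact (le_abs_self _).trans (hx a)
      have hmul : ‖a‖ * ‖a‖ < √d * ‖a‖ := by
        rw [← sq]
        exact hle.trans_lt (hLlt a h0)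
      exact (Real.lt_sqrt (norm_nonneg a)).1 (lt_of_mul_lt_mul_right hmul (norm_nonneg a))
  have hsum : Integrable (fun x ↦ ∑ i, e i x ^ 2) P := integrable_finsetSum _ fun i _ ↦ hint i
  have hzero : ∫ x, (d - ∑ i, e i x ^ 2) ∂P = 0 := by
    rw [integral_sub (integrable_const _) hsum, integral_finsetSum _ fun i _ ↦ hint i]
    simp [Lp.integral_sq_eq_norm_topToTwo_sq, e, hL]
  rw [integral_eq_zero_iff_of_nonneg_ae (hpos.mono fun _ h ↦ h.le)
    ((integrable_const _).sub hsum)] at hzero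
  obtain ⟨x, hx, hx'⟩ := (hpos.and hzero).exists
  exact hx.ne' hx'
end

section
/- Let S be a nonempty finite set and let F be a nonzero linear subspace of the space of functions ψ : S → ℂ. Then there exists ψ ∈ F with ψ ≠ 0 such that |S| · max_{x∈S} |ψ(x)|² ≥ (dim F) · ∑_{x∈S} |ψ(x)|². -/
/-- Evaluating at `x` the kernel vector of a subspace of `ℂ^S` built from an orthonormal basis `b`
gives a vector `ψ` with `ψ x = ∑ i, ‖b i x‖ ^ 2 = ‖ψ‖ ^ 2`. -/
theorem OrthonormalBasis.exists_apply_eq_sum_norm_sq {S ι : Type*} [Fintype S] [Fintype ι]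
    {G : Submodule ℂ (EuclideanSpace ℂ S)} (b : OrthonormalBasis ι ℂ G) (x : S) :
    ∃ ψ : G, (ψ : EuclideanSpace ℂ S) x
        = ((∑ i, ‖(b i : EuclideanSpace ℂ S) x‖ ^ 2 : ℝ) : ℂ) ∧
      ∑ y, ‖(ψ : EuclideanSpace ℂ S) y‖ ^ 2 = ∑ i, ‖(b i : EuclideanSpace ℂ S) x‖ ^ 2 := by
  let c : EuclideanSpace ℂ ι :=
    WithLp.toLp 2 fun i => starRingEnd ℂ ((b i : EuclideanSpace ℂ S) x)
  refine ⟨b.repr.symm c, ?_, ?_⟩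
  · rw [← b.sum_repr (b.repr.symm c)]
    simp [c, Complex.conj_mul']
  · rw [← EuclideanSpace.norm_sq_eq, Submodule.norm_coe, LinearIsometryEquiv.norm_map,
      EuclideanSpace.norm_sq_eq]
    simp [c]

theorem OrthonormalBasis.sum_sum_norm_sq {S ι : Type*} [Fintype S] [Fintype ι]
    {G : Submodule ℂ (EuclideanSpace ℂ S)} (b : OrthonormalBasis ι ℂ G) :
    ∑ x, ∑ i, ‖(b i : EuclideanSpace ℂ S) x‖ ^ 2 = Fintype.card ι := by
  rw [Finset.sum_comm]
  simp [← EuclideanSpace.norm_sq_eq, Submodule.norm_coe, b.norm_eq_one]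

/-- Let `S` be a nonempty finite set and `F` a nonzero linear subspace of
the functions `ψ : S → ℂ`.  Then there is `ψ ∈ F`, `ψ ≠ 0`, with
`|S| · max_{x∈S} |ψ(x)|² ≥ (dim F) · ∑_{x∈S} |ψ(x)|²`. -/
theorem exists_large_max_of_subspace
    {S : Type*} [Fintype S] [Nonempty S] (F : Submodule ℂ (S → ℂ)) (hF : F ≠ ⊥) :
    ∃ ψ ∈ F, ψ ≠ 0 ∧
      (Module.finrank ℂ F : ℝ) * ∑ x, ‖ψ x‖ ^ 2 ≤
        (Fintype.card S : ℝ) *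
          Finset.univ.sup' Finset.univ_nonempty (fun x => ‖ψ x‖ ^ 2) := by
  let e := (WithLp.linearEquiv 2 ℂ (S → ℂ)).symm
  let G : Submodule ℂ (EuclideanSpace ℂ S) := F.map e.toLinearMap
  have hG : Module.finrank ℂ G = Module.finrank ℂ F := LinearEquiv.finrank_map_eq e F
  have hd : 0 < Module.finrank ℂ F :=
    Module.finrank_pos_iff.mpr ((Submodule.nontrivial_iff_ne_bot).mpr hF)
  let b := stdOrthonormalBasis ℂ G
  let K : S → ℝ := fun x => ∑ i, ‖(b i : EuclideanSpace ℂ S) x‖ ^ 2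
  have hK : ∑ x, K x = Module.finrank ℂ F := by
    simpa [hG] using b.sum_sum_norm_sq
  obtain ⟨x, -, hx⟩ := Finset.exists_max_image Finset.univ K Finset.univ_nonempty
  have hcard : (Module.finrank ℂ F : ℝ) ≤ Fintype.card S * K x := by
    rw [← hK]
    simpa using Finset.sum_le_card_nsmul Finset.univ K (K x) hx
  have hKx : 0 < K x := by
    have : (0 : ℝ) < Fintype.card S * K x := lt_of_lt_of_le (by exact_mod_cast hd) hcard
    exact pos_of_mul_pos_right this (Nat.cast_nonneg _)
  obtain ⟨⟨_, ψ, hψ, rfl⟩, hval, hnorm⟩ := b.exists_apply_eq_sum_norm_sq x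
  change ψ x = (K x : ℂ) at hval
  change ∑ y, ‖ψ y‖ ^ 2 = K x at hnorm
  refine ⟨ψ, hψ, ?_, ?_⟩
  · rintro rfl
    simp [hKx.ne] at hnorm
  · have hsup := Finset.le_sup' (fun y => ‖ψ y‖ ^ 2) (Finset.mem_univ x)
    have hsq : ‖ψ x‖ ^ 2 = K x ^ 2 := by
      rw [hval, Complex.norm_real, Real.norm_eq_abs, sq_abs]
    calc (Module.finrank ℂ F : ℝ) * ∑ y, ‖ψ y‖ ^ 2
        ≤ (Fintype.card S * K x) * K x := by rw [hnorm]; gcongr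
      _ = Fintype.card S * ‖ψ x‖ ^ 2 := by rw [hsq]; ring
      _ ≤ _ := by gcongr
end

section
/- Let a < b be real numbers, K ≥ 1, let ψ : [a,b] → ℝ be twice continuously differentiable with ψ(a) = ψ'(a) = 0, and let g : [a,b] → [0,∞) be continuous with |ψ''(x)| ≤ (K−1)|ψ(x)| + g(x) for all x ∈ [a,b]. Then for all x ∈ [a,b], |ψ(x)| + |ψ'(x)| ≤ e^{K(x−a)} ∫_a^x e^{−K(y−a)} g(y) dy. In particular, |ψ(x)| ≤ (2K)^{−1/2} e^{K(x−a)} (∫_a^b g(y)² dy)^{1/2} for all x ∈ [a,b]. -/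
open Set intervalIntegral

/-- A right derivative bound `‖f'‖ ≤ K ‖f‖ + g` with `f a = 0` gives the Gronwall estimate with the
variable forcing term `g`. -/
theorem norm_le_exp_mul_integral_of_norm_deriv_right_le
    {E : Type*} [NormedAddCommGroup E] [NormedSpace ℝ E] {a b K : ℝ} {f f' : ℝ → E} {g : ℝ → ℝ}
    (hf : ContinuousOn f (Icc a b)) (hf' : ∀ x ∈ Ico a b, HasDerivWithinAt f (f' x) (Ici x) x)
    (hg : ContinuousOn g (Icc a b)) (ha : f a = 0)
    (bound : ∀ x ∈ Ico a b, ‖f' x‖ ≤ K * ‖f x‖ + g x) {x : ℝ} (hx : x ∈ Icc a b) :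
    ‖f x‖ ≤ Real.exp (K * (x - a)) * ∫ y in a..x, Real.exp (-K * (y - a)) * g y := by
  have hab : a ≤ b := hx.1.trans hx.2
  set h : ℝ → ℝ := fun y => Real.exp (-K * (y - a)) * g y with hh
  have hc : ContinuousOn h (Icc a b) := by fun_prop
  have hint : IntervalIntegrable h MeasureTheory.volume a b :=
    hc.intervalIntegrable_of_Icc hab
  have hI : ContinuousOn (fun z => ∫ y in a..z, h y) (Icc a b) := by
    have := continuousOn_primitive_interval' hint left_mem_uIcc
    rwa [uIcc_of_le hab] at this
  have hI' : ∀ z ∈ Ico a b, HasDerivWithinAt (fun z => ∫ y in a..z, h y) (h z) (Ici z) z := by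
    intro z hz
    have hsub : Ioo z b ⊆ Icc a b := fun y hy => ⟨hz.1.trans hy.1.le, hy.2.le⟩
    refine integral_hasDerivWithinAt_right (t := Ioi z)
      ((hc.mono (Icc_subset_Icc_right hz.2.le)).intervalIntegrable_of_Icc hz.1) ?_ ?_
    · exact ⟨Ioo z b, Ioo_mem_nhdsGT hz.2,
        (hc.mono hsub).aestronglyMeasurable measurableSet_Ioo⟩
    · have := (hc z ⟨hz.1, hz.2.le⟩).mono hsub
      rwa [ContinuousWithinAt, nhdsWithin_Ioo_eq_nhdsGT hz.2] at this
  have key : ∀ ε > 0,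
      ‖f x‖ ≤ Real.exp (K * (x - a)) * ((∫ y in a..x, h y) + ε * (1 + (x - a))) := by
    intro ε hε
    have hB' : ∀ z ∈ Ico a b, HasDerivWithinAt
        (fun z => Real.exp (K * (z - a)) * ((∫ y in a..z, h y) + ε * (1 + (z - a))))
        (Real.exp (K * (z - a)) * K * ((∫ y in a..z, h y) + ε * (1 + (z - a))) +
          Real.exp (K * (z - a)) * (h z + ε)) (Ici z) z := by
      intro z hz
      have hid := (hasDerivWithinAt_id z (Ici z)).sub_const a
      have h1 := (hid.const_mul K).exp
      have h2 := (hI' z hz).add ((hid.const_add 1).const_mul ε)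
      exact (h1.mul h2).congr_deriv (by simp)
    refine image_norm_le_of_norm_deriv_right_lt_deriv_boundary' hf hf' ?_ ?_ hB' ?_ hx
    · simp [ha, hε.le]
    · fun_prop
    · intro z hz heq
      have hexp : Real.exp (K * (z - a)) * h z = g z := by
        rw [hh, ← mul_assoc, ← Real.exp_add]
        simp
      have hpos : 0 < Real.exp (K * (z - a)) * ε := by positivity
      have hbz := bound z hz
      rw [heq] at hbz
      linarith
  refine le_of_forall_pos_le_add fun δ hδ => ?_
  have hc0 : 0 < Real.exp (K * (x - a)) * (1 + (x - a)) := by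
    have := hx.1
    exact mul_pos (Real.exp_pos _) (by linarith)
  refine (key (δ / (Real.exp (K * (x - a)) * (1 + (x - a)))) (div_pos hδ hc0)).trans_eq ?_
  have : 1 + (x - a) ≠ 0 := (pos_of_mul_pos_right hc0 (Real.exp_pos _).le).ne'
  field_simp

/-- Cauchy–Schwarz inequality for interval integrals of continuous functions. -/
theorem sq_intervalIntegral_mul_le {a b : ℝ} (hab : a ≤ b) {u v : ℝ → ℝ}
    (hu : ContinuousOn u (Icc a b)) (hv : ContinuousOn v (Icc a b)) :
    (∫ y in a..b, u y * v y) ^ 2 ≤ (∫ y in a..b, u y ^ 2) * ∫ y in a..b, v y ^ 2 := by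
  have hnonneg : ∀ t : ℝ, 0 ≤ (∫ y in a..b, u y ^ 2) * (t * t) +
      (-2 * ∫ y in a..b, u y * v y) * t + ∫ y in a..b, v y ^ 2 := by
    intro t
    have h0 : 0 ≤ ∫ y in a..b, (t * u y - v y) ^ 2 :=
      integral_nonneg hab fun _ _ => sq_nonneg _
    have i1 : IntervalIntegrable (fun y => t * t * u y ^ 2) MeasureTheory.volume a b :=
      ContinuousOn.intervalIntegrable_of_Icc hab (by fun_prop)
    have i2 : IntervalIntegrable (fun y => -2 * t * (u y * v y)) MeasureTheory.volume a b :=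
      ContinuousOn.intervalIntegrable_of_Icc hab (by fun_prop)
    have i3 : IntervalIntegrable (fun y => v y ^ 2) MeasureTheory.volume a b :=
      ContinuousOn.intervalIntegrable_of_Icc hab (by fun_prop)
    have hexpand : (fun y => (t * u y - v y) ^ 2) =
        fun y => t * t * u y ^ 2 + -2 * t * (u y * v y) + v y ^ 2 := by
      funext y
      ring
    rw [hexpand, integral_add (i1.add i2) i3, integral_add i1 i2, integral_const_mul,
      integral_const_mul] at h0
    linarith
  have := discrim_le_zero hnonneg
  rw [discrim] at this
  linarith

theorem integral_sq_exp_neg_mul_sub_le {K : ℝ} (hK : 0 < K) (a x : ℝ) :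
    ∫ y in a..x, Real.exp (-K * (y - a)) ^ 2 ≤ (2 * K)⁻¹ := by
  have hderiv : ∀ y ∈ uIcc a x, HasDerivAt (fun y => -(2 * K)⁻¹ * Real.exp (-K * (y - a)) ^ 2)
      (Real.exp (-K * (y - a)) ^ 2) y := by
    intro y _
    have h := (((((hasDerivAt_id y).sub_const a).const_mul (-K)).exp).pow 2).const_mul
      (-(2 * K)⁻¹)
    refine h.congr_deriv ?_
    simp
    field_simp
  rw [integral_eq_sub_of_hasDerivAt hderiv (Continuous.intervalIntegrable (by fun_prop) _ _)]
  have : 0 ≤ (2 * K)⁻¹ * Real.exp (-K * (x - a)) ^ 2 := by positivity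
  simp only [sub_self, mul_zero, Real.exp_zero]
  linarith

/-- Gronwall-type estimate: if `ψ` is twice continuously differentiable on
`[a,b]` with `ψ(a) = ψ'(a) = 0`, `K ≥ 1`, `g ≥ 0` continuous, and
`|ψ''| ≤ (K-1)|ψ| + g` on `[a,b]`, then for all `x ∈ [a,b]`
`|ψ(x)| + |ψ'(x)| ≤ e^{K(x-a)} ∫_a^x e^{-K(y-a)} g(y) dy`, and in particular
`|ψ(x)| ≤ (2K)^{-1/2} e^{K(x-a)} (∫_a^b g²)^{1/2}`. -/
theorem gronwall_schrodinger_estimate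
    (a b K : ℝ) (hab : a < b) (hK : 1 ≤ K)
    (ψ ψ' ψ'' g : ℝ → ℝ)
    (hderiv1 : ∀ x ∈ Icc a b, HasDerivWithinAt ψ (ψ' x) (Icc a b) x)
    (hderiv2 : ∀ x ∈ Icc a b, HasDerivWithinAt ψ' (ψ'' x) (Icc a b) x)
    (hcont : ContinuousOn ψ'' (Icc a b))
    (hgcont : ContinuousOn g (Icc a b)) (hg0 : ∀ x ∈ Icc a b, 0 ≤ g x)
    (hbound : ∀ x ∈ Icc a b, |ψ'' x| ≤ (K - 1) * |ψ x| + g x)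
    (ha : ψ a = 0) (ha' : ψ' a = 0) :
    ∀ x ∈ Icc a b,
      (|ψ x| + |ψ' x| ≤
          Real.exp (K * (x - a)) * ∫ y in a..x, Real.exp (-K * (y - a)) * g y) ∧
        |ψ x| ≤ (Real.sqrt (2 * K))⁻¹ * Real.exp (K * (x - a)) *
          Real.sqrt (∫ y in a..b, g y ^ 2) := by
  intro x hx
  have hK0 : 0 < K := by linarith
  have hfirst : |ψ x| + |ψ' x| ≤
      Real.exp (K * (x - a)) * ∫ y in a..x, Real.exp (-K * (y - a)) * g y := by
    let e := (WithLp.prodContinuousLinearEquiv 1 ℝ ℝ ℝ).symm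
    have hnorm : ∀ p q : ℝ, ‖e (p, q)‖ = |p| + |q| := fun p q => by
      simp [e, WithLp.prod_norm_eq_of_L1]
    have hder : ∀ z ∈ Icc a b, HasDerivWithinAt (fun z => e (ψ z, ψ' z))
        (e (ψ' z, ψ'' z)) (Icc a b) z := fun z hz =>
      e.toContinuousLinearMap.hasFDerivAt.comp_hasDerivWithinAt z
        ((hderiv1 z hz).prodMk (hderiv2 z hz))
    rw [← hnorm]
    refine norm_le_exp_mul_integral_of_norm_deriv_right_le
      (f := fun z => e (ψ z, ψ' z)) (f' := fun z => e (ψ' z, ψ'' z))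
      (fun z hz => (hder z hz).continuousWithinAt) ?_ hgcont ?_ ?_ hx
    · intro z hz
      exact (hder z (Ico_subset_Icc_self hz)).mono_of_mem_nhdsWithin
        (Icc_mem_nhdsGE_of_mem hz)
    · simp only [ha, ha']
      exact map_zero e
    · intro z hz
      rw [hnorm, hnorm]
      have h1 := hbound z (Ico_subset_Icc_self hz)
      have h2 : 0 ≤ (K - 1) * |ψ' z| := mul_nonneg (by linarith) (abs_nonneg _)
      linarith [abs_nonneg (ψ z)]
  refine ⟨hfirst, (le_add_of_nonneg_right (abs_nonneg _)).trans (hfirst.trans ?_)⟩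
  have hsq : IntervalIntegrable (fun y => g y ^ 2) MeasureTheory.volume a b :=
    (hgcont.pow 2).intervalIntegrable_of_Icc hab.le
  have hmono : ∫ y in a..x, g y ^ 2 ≤ ∫ y in a..b, g y ^ 2 :=
    integral_mono_interval le_rfl hx.1 hx.2 (.of_forall fun y => sq_nonneg (g y)) hsq
  have hcs : (∫ y in a..x, Real.exp (-K * (y - a)) * g y) ^ 2 ≤
      (2 * K)⁻¹ * ∫ y in a..b, g y ^ 2 :=
    (sq_intervalIntegral_mul_le hx.1 (by fun_prop)
      (hgcont.mono (Icc_subset_Icc_right hx.2))).trans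
      (mul_le_mul (integral_sq_exp_neg_mul_sub_le hK0 a x) hmono
        (integral_nonneg hx.1 fun _ _ => sq_nonneg _) (by positivity))
  have hroot := Real.le_sqrt_of_sq_le hcs
  rw [Real.sqrt_mul (by positivity), Real.sqrt_inv] at hroot
  calc _ ≤ Real.exp (K * (x - a)) *
        ((Real.sqrt (2 * K))⁻¹ * Real.sqrt (∫ y in a..b, g y ^ 2)) := by gcongr
    _ = _ := by ring
end
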